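/- arXiv:math/0212242 — 5 statements merged into one kernel-verified Lean document; each statement's English description precedes it below -/
import Mathlib

section
/- If a directed graph E is cofinal, then either E has no loops, or there exists a strongly connected cofinal subgraph F of E. -/
/-- A directed graph with vertex type `V` and edge type `E`. -/
structure DiGraph (V : Type) (E : Type) where
  s : E → V
  r : E → V

namespace DiGraph

variable {V E : Type} (G : DiGraph V E)

/-- A dart is an edge traversed forwards (`inl`) or backwards (`inr`). -/
def dartS : E ⊕ E → V := fun d => match d with | .inl e => G.s e | .inr e => G.r e

def dartR : E ⊕ E → V := fun d => match d with | .inl e => G.r e | .inr e => G.s e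

/-- `l` is a walk (as a list of darts). -/
def IsWalk (l : List (E ⊕ E)) : Prop := l.Chain' (fun d d' => G.dartR d = G.dartS d')

/-- `l` is a walk from `v` to `w`. -/
def IsWalkFrom (v w : V) (l : List (E ⊕ E)) : Prop :=
  G.IsWalk l ∧ (∀ d ∈ l.head?, G.dartS d = v) ∧ (∀ d ∈ l.getLast?, G.dartR d = w) ∧
    (l = [] → v = w)

/-- `l` is a (directed) path, as a list of edges. -/
def IsPath (l : List E) : Prop := l.Chain' (fun e e' => G.r e = G.s e')

/-- `l` is a path from `v` to `w` (vertices count as paths of length `0`). -/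
def IsPathFrom (v w : V) (l : List E) : Prop :=
  G.IsPath l ∧ (∀ e ∈ l.head?, G.s e = v) ∧ (∀ e ∈ l.getLast?, G.r e = w) ∧
    (l = [] → v = w)

/-- An infinite path. -/
def IsInfPath (x : ℕ → E) : Prop := ∀ i, G.r (x i) = G.s (x (i + 1))

/-- The graph is cofinal. -/
def Cofinal : Prop :=
  ∀ x : ℕ → E, G.IsInfPath x → ∀ v : V, ∃ n : ℕ, ∃ l : List E, G.IsPathFrom v (G.r (x n)) l

/-- The graph is strongly connected. -/
def StronglyConnected : Prop :=
  ∀ v w : V, ∃ l : List E, l ≠ [] ∧ G.IsPathFrom v w l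

/-- The set of lengths of loops based at `v`. -/
def loopLengths (v : V) : Set ℕ :=
  {n | 0 < n ∧ ∃ l : List E, l.length = n ∧ G.IsPathFrom v v l}

/-- Two vertices are joined by a walk. -/
def Reachable (v w : V) : Prop := ∃ l : List (E ⊕ E), G.IsWalkFrom v w l

/-- The graph is connected. -/
def Connected : Prop := ∀ v w : V, G.Reachable v w

end DiGraph

/-- `d` is the greatest common divisor of the set `S` of natural numbers. -/
def IsGcdOf (d : ℕ) (S : Set ℕ) : Prop :=
  (∀ n ∈ S, d ∣ n) ∧ ∀ k : ℕ, (∀ n ∈ S, k ∣ n) → k ∣ d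

/-- The skew product graph `E ×_c Γ`. -/
def DiGraph.skew {V E : Type} (G : DiGraph V E) (Γ : Type) [Group Γ] (c : E → Γ) :
    DiGraph (V × Γ) (E × Γ) where
  s := fun x => (G.s x.1, x.2)
  r := fun x => (G.r x.1, x.2 * c x.1)

/-- The label of a walk: the product of the labels of its darts. -/
def cWalk {E Γ : Type} [Group Γ] (c : E → Γ) (l : List (E ⊕ E)) : Γ :=
  (l.map (fun d => match d with | .inl e => c e | .inr e => (c e)⁻¹)).prod

/-- The local voltage group of `c` based at `v`, as a set. -/
def voltage {V E : Type} (G : DiGraph V E) {Γ : Type} [Group Γ] (c : E → Γ) (v : V) : Set Γ :=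
  {g | ∃ l : List (E ⊕ E), G.IsWalkFrom v v l ∧ cWalk c l = g}

namespace DiGraph

/-- There is an edge from `v` to `w`. -/
def Step {V E : Type} (G : DiGraph V E) (v w : V) : Prop := ∃ e, G.s e = v ∧ G.r e = w

/-- The vertices lying on a common loop with `v`. -/
def loopComponent {V E : Type} (G : DiGraph V E) (v : V) : Set V :=
  {w | Relation.TransGen G.Step v w ∧ Relation.TransGen G.Step w v}

theorem isPathFrom_cons {V E : Type} (G : DiGraph V E) {v w : V} {e : E} {l : List E} :
    G.IsPathFrom v w (e :: l) ↔ G.s e = v ∧ G.IsPathFrom (G.r e) w l := by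
  cases l with
  | nil => simp [IsPathFrom, IsPath, List.Chain']
  | cons f l =>
    simp [IsPathFrom, IsPath, List.Chain']
    grind

theorem IsPathFrom.reflTransGen {V E : Type} {G : DiGraph V E} {v w : V} {l : List E}
    (h : G.IsPathFrom v w l) : Relation.ReflTransGen G.Step v w := by
  induction l generalizing v with
  | nil => rw [h.2.2.2 rfl]
  | cons e l ih =>
    obtain ⟨hs, hl⟩ := G.isPathFrom_cons.1 h
    exact .head ⟨e, hs, rfl⟩ (ih hl)

theorem IsPathFrom.transGen {V E : Type} {G : DiGraph V E} {v w : V} {l : List E}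
    (h : G.IsPathFrom v w l) (hl : l ≠ []) : Relation.TransGen G.Step v w := by
  cases l with
  | nil => exact absurd rfl hl
  | cons e l =>
    obtain ⟨hs, hl⟩ := G.isPathFrom_cons.1 h
    exact .head' ⟨e, hs, rfl⟩ hl.reflTransGen

theorem exists_isPathFrom_in_loopComponent {V E : Type} (G : DiGraph V E) {u v w : V}
    (hv : v ∈ G.loopComponent u) (hw : w ∈ G.loopComponent u) :
    ∃ l : List E, l ≠ [] ∧
      (∀ e ∈ l, G.s e ∈ G.loopComponent u ∧ G.r e ∈ G.loopComponent u) ∧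
      G.IsPathFrom v w l := by
  have h : Relation.TransGen G.Step v w := hv.2.trans hw.1
  induction h using Relation.TransGen.head_induction_on with
  | single h =>
    obtain ⟨e, rfl, rfl⟩ := h
    exact ⟨[e], by simp, by simpa using ⟨hv, hw⟩,
      G.isPathFrom_cons.2 ⟨rfl, List.isChain_nil, by simp, by simp, fun _ => rfl⟩⟩
  | head h hcw ih =>
    obtain ⟨e, rfl, rfl⟩ := h
    have hr : G.r e ∈ G.loopComponent u := ⟨hv.1.tail ⟨e, rfl, rfl⟩, hcw.trans hw.2⟩
    obtain ⟨l, -, hl, hp⟩ := ih hr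
    exact ⟨e :: l, by simp, by simpa using ⟨⟨hv, hr⟩, hl⟩, G.isPathFrom_cons.2 ⟨rfl, hp⟩⟩

theorem exists_edge_in_loopComponent {V E : Type} (G : DiGraph V E) {u v : V}
    (hv : v ∈ G.loopComponent u) : ∃ e, G.s e = v ∧ G.r e ∈ G.loopComponent u := by
  obtain ⟨l, hne, hl, hp⟩ := G.exists_isPathFrom_in_loopComponent hv hv
  cases l with
  | nil => exact absurd rfl hne
  | cons e l => exact ⟨e, (G.isPathFrom_cons.1 hp).1, (hl e (by simp)).2⟩

theorem exists_isInfPath_in_loopComponent {V E : Type} (G : DiGraph V E) {v : V}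
    (hv : v ∈ G.loopComponent v) :
    ∃ x : ℕ → E, G.IsInfPath x ∧ ∀ n, G.r (x n) ∈ G.loopComponent v := by
  choose f hfs hfr using fun w : G.loopComponent v => G.exists_edge_in_loopComponent w.2
  let y : ℕ → G.loopComponent v := fun n => (fun w => ⟨G.r (f w), hfr w⟩)^[n] ⟨v, hv⟩
  refine ⟨fun n => f (y n), fun n => ?_, fun n => hfr (y n)⟩
  simp only [hfs, y, Function.iterate_succ_apply']

theorem IsInfPath.reflTransGen {V E : Type} {G : DiGraph V E} {x : ℕ → E}
    (hx : G.IsInfPath x) {m n : ℕ} (hmn : m ≤ n) :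
    Relation.ReflTransGen G.Step (G.r (x m)) (G.r (x n)) := by
  induction n, hmn using Nat.le_induction with
  | base => exact .refl
  | succ n _ ih => exact ih.tail ⟨x (n + 1), (hx n).symm, rfl⟩

theorem Cofinal.transGen_of_mem_loopComponent {V E : Type} {G : DiGraph V E} (hG : G.Cofinal)
    {v : V} (hv : v ∈ G.loopComponent v) (w : V) : Relation.TransGen G.Step w v := by
  obtain ⟨x, hx, hxv⟩ := G.exists_isInfPath_in_loopComponent hv
  obtain ⟨n, l, hl⟩ := hG x hx w
  exact Relation.TransGen.trans_right hl.reflTransGen (hxv n).2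

end DiGraph

/-- If a directed graph `E` is cofinal then either it has no loops or
it has a strongly connected cofinal subgraph. -/
theorem cofinal_no_loops_or_strongly_connected_cofinal_subgraph
    {V E : Type} (G : DiGraph V E) (hcof : G.Cofinal) :
    (¬ ∃ (v : V) (l : List E), l ≠ [] ∧ G.IsPathFrom v v l) ∨
    (∃ (V₀ : Set V) (E₀ : Set E),
      -- `(V₀, E₀)` is a subgraph of `G`
      (∀ e ∈ E₀, G.s e ∈ V₀ ∧ G.r e ∈ V₀) ∧
      -- it is strongly connected: any two of its vertices are joined by a nonempty
      -- path entirely inside the subgraph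
      (∀ v ∈ V₀, ∀ w ∈ V₀, ∃ l : List E, l ≠ [] ∧ (∀ e ∈ l, e ∈ E₀) ∧
        G.IsPathFrom v w l) ∧
      -- it is a cofinal subgraph: every infinite path in `G` eventually stays in `V₀`
      (∀ x : ℕ → E, G.IsInfPath x → ∃ N : ℕ, ∀ n ≥ N, G.r (x n) ∈ V₀)) := by
  refine or_iff_not_imp_left.2 fun hloop => ?_
  obtain ⟨v, l, hne, hl⟩ := not_not.1 hloop
  have hv : v ∈ G.loopComponent v := ⟨hl.transGen hne, hl.transGen hne⟩
  refine ⟨G.loopComponent v, {e | G.s e ∈ G.loopComponent v ∧ G.r e ∈ G.loopComponent v},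
    fun e he => he, fun a ha b hb => G.exists_isPathFrom_in_loopComponent ha hb,
    fun x hx => ?_⟩
  obtain ⟨N, p, hp⟩ := hcof x hx v
  exact ⟨N, fun n hn => ⟨hv.1.trans_left (hp.reflTransGen.trans (hx.reflTransGen hn)),
    hcof.transGen_of_mem_loopComponent hv _⟩⟩
end

section
/- Let E be a directed graph, Γ a group, and c₁, c₂ : E¹ → Γ cohomologous labellings, say c₁(e)·b(r(e)) = b(s(e))·c₂(e) for all edges e, where b : E⁰ → Γ. Then the maps (v,g) ↦ (v, g·b(v)) on vertices and (e,g) ↦ (e, g·b(s(e))) on edges define an isomorphism of directed graphs from E ×_{c₁} Γ to E ×_{c₂} Γ (a bijective graph morphism on vertices and edges). -/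
/-- Right translation by a group element depending on the first coordinate is a bijection. -/
theorem bijective_twist {X Γ : Type*} [Group Γ] (f : X → Γ) :
    Function.Bijective (fun p : X × Γ => (p.1, p.2 * f p.1)) :=
  (Equiv.prodShear (Equiv.refl X) fun x => Equiv.mulRight (f x)).bijective

/-- Cohomologous labellings give isomorphic skew product graphs, via
`(v,g) ↦ (v, g·b(v))` on vertices and `(e,g) ↦ (e, g·b(s(e)))` on edges. -/
theorem cohomologous_skew_iso
    {V E : Type} (G : DiGraph V E) {Γ : Type} [Group Γ]
    (c₁ c₂ : E → Γ) (b : V → Γ)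
    (hb : ∀ e : E, c₁ e * b (G.r e) = b (G.s e) * c₂ e) :
    Function.Bijective (fun p : V × Γ => (p.1, p.2 * b p.1)) ∧
    Function.Bijective (fun x : E × Γ => (x.1, x.2 * b (G.s x.1))) ∧
    (∀ x : E × Γ,
      (G.skew Γ c₂).s (x.1, x.2 * b (G.s x.1)) =
        (fun p : V × Γ => (p.1, p.2 * b p.1)) ((G.skew Γ c₁).s x)) ∧
    (∀ x : E × Γ,
      (G.skew Γ c₂).r (x.1, x.2 * b (G.s x.1)) =
        (fun p : V × Γ => (p.1, p.2 * b p.1)) ((G.skew Γ c₁).r x)) := by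
  refine ⟨bijective_twist b, bijective_twist fun e => b (G.s e), fun x => rfl, fun x => ?_⟩
  simp only [DiGraph.skew, mul_assoc, hb]
end

section
/- Let E be a connected directed graph, Γ a group, and c : E¹ → Γ a function. Then two vertices (v,g) and (u,h) lie in the same connected component of the skew product graph E ×_c Γ if and only if there is a walk a in E from v to u such that g⁻¹h lies in the coset Γ_v(c)·c(a) of the local voltage group of c based at v. -/
namespace DiGraph

variable {V E : Type} {G : DiGraph V E}

theorem isWalk_iff_isChain {l : List (E ⊕ E)} :
    G.IsWalk l ↔ l.IsChain (fun d d' => G.dartR d = G.dartS d') :=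
  Iff.rfl

theorem isWalkFrom_nil {v w : V} : G.IsWalkFrom v w [] ↔ v = w := by
  simp [IsWalkFrom, isWalk_iff_isChain]

theorem isWalkFrom_cons {v w : V} {d : E ⊕ E} {l : List (E ⊕ E)} :
    G.IsWalkFrom v w (d :: l) ↔ G.dartS d = v ∧ G.IsWalkFrom (G.dartR d) w l := by
  cases l with
  | nil => simp [IsWalkFrom, isWalk_iff_isChain]
  | cons d' l =>
    simp only [IsWalkFrom, isWalk_iff_isChain, List.isChain_cons_cons, List.head?_cons,
      Option.mem_some_iff, List.getLast?_cons_cons, forall_eq', reduceCtorEq, false_imp_iff,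
      and_true, eq_comm (a := G.dartR d)]
    tauto

theorem IsWalkFrom.append {v w x : V} {l l' : List (E ⊕ E)} (hl : G.IsWalkFrom v w l)
    (hl' : G.IsWalkFrom w x l') : G.IsWalkFrom v x (l ++ l') := by
  induction l generalizing v with
  | nil => rw [isWalkFrom_nil] at hl; simpa [hl] using hl'
  | cons d l ih =>
    rw [isWalkFrom_cons] at hl
    rw [List.cons_append, isWalkFrom_cons]
    exact ⟨hl.1, ih hl.2⟩

end DiGraph

theorem cWalk_nil {E Γ : Type} [Group Γ] (c : E → Γ) : cWalk c [] = 1 := by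
  simp [cWalk]

theorem cWalk_append {E Γ : Type} [Group Γ] (c : E → Γ) (l l' : List (E ⊕ E)) :
    cWalk c (l ++ l') = cWalk c l * cWalk c l' := by
  simp [cWalk]

theorem cWalk_inl_cons {E Γ : Type} [Group Γ] (c : E → Γ) (e : E) (l : List (E ⊕ E)) :
    cWalk c (.inl e :: l) = c e * cWalk c l := by
  simp [cWalk]

theorem cWalk_inr_cons {E Γ : Type} [Group Γ] (c : E → Γ) (e : E) (l : List (E ⊕ E)) :
    cWalk c (.inr e :: l) = (c e)⁻¹ * cWalk c l := by
  simp [cWalk]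

/-- Walks in the skew product project to walks in the base whose label is the ratio of the
second coordinates of the endpoints. -/
theorem DiGraph.IsWalkFrom.exists_of_skew {V E Γ : Type} [Group Γ] {G : DiGraph V E} {c : E → Γ}
    {v u : V} {g h : Γ} {l : List ((E × Γ) ⊕ (E × Γ))}
    (hl : (G.skew Γ c).IsWalkFrom (v, g) (u, h) l) :
    ∃ a : List (E ⊕ E), G.IsWalkFrom v u a ∧ g * cWalk c a = h := by
  induction l generalizing v g with
  | nil =>
    obtain ⟨rfl, rfl⟩ := Prod.mk.inj (isWalkFrom_nil.1 hl)
    exact ⟨[], isWalkFrom_nil.2 rfl, by simp [cWalk_nil]⟩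
  | cons d l ih =>
    obtain ⟨hd, htail⟩ := isWalkFrom_cons.1 hl
    rcases d with ⟨e, k⟩ | ⟨e, k⟩
    · obtain ⟨rfl, rfl⟩ := Prod.mk.inj hd
      obtain ⟨a, ha, hc⟩ := ih htail
      exact ⟨.inl e :: a, isWalkFrom_cons.2 ⟨rfl, ha⟩, by rw [cWalk_inl_cons, ← mul_assoc, hc]⟩
    · obtain ⟨rfl, rfl⟩ := Prod.mk.inj hd
      obtain ⟨a, ha, hc⟩ := ih htail
      exact ⟨.inr e :: a, isWalkFrom_cons.2 ⟨rfl, ha⟩, by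
        rw [cWalk_inr_cons, ← mul_assoc, mul_inv_cancel_right, hc]⟩

/-- A walk in the base lifts to the skew product from any starting point over its source. -/
theorem DiGraph.IsWalkFrom.skew_reachable {V E Γ : Type} [Group Γ] {G : DiGraph V E} (c : E → Γ)
    {v u : V} {a : List (E ⊕ E)} (ha : G.IsWalkFrom v u a) (g : Γ) :
    (G.skew Γ c).Reachable (v, g) (u, g * cWalk c a) := by
  induction a generalizing v g with
  | nil =>
    obtain rfl := isWalkFrom_nil.1 ha
    exact ⟨[], isWalkFrom_nil.2 (by simp [cWalk_nil])⟩
  | cons d a ih =>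
    obtain ⟨rfl, htail⟩ := isWalkFrom_cons.1 ha
    rcases d with e | e
    · obtain ⟨l, hl⟩ := ih htail (g * c e)
      rw [cWalk_inl_cons, ← mul_assoc]
      exact ⟨.inl (e, g) :: l, isWalkFrom_cons.2 ⟨rfl, hl⟩⟩
    · obtain ⟨l, hl⟩ := ih htail (g * (c e)⁻¹)
      rw [cWalk_inr_cons, ← mul_assoc]
      exact ⟨.inr (e, g * (c e)⁻¹) :: l, isWalkFrom_cons.2
        ⟨Prod.ext rfl (inv_mul_cancel_right g (c e)), hl⟩⟩

/-- In the skew product of a connected graph, `(v,g)` and `(u,h)` lie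
in the same connected component iff there is a walk `a` from `v` to `u` in `E` with
`g⁻¹h ∈ Γ_v(c)·c(a)`. -/
theorem skew_component_criterion
    {V E : Type} (G : DiGraph V E) {Γ : Type} [Group Γ] (c : E → Γ)
    (hconn : G.Connected) (v u : V) (g h : Γ) :
    (G.skew Γ c).Reachable (v, g) (u, h) ↔
      ∃ a : List (E ⊕ E), G.IsWalkFrom v u a ∧
        ∃ k ∈ voltage G c v, g⁻¹ * h = k * cWalk c a := by
  constructor
  · rintro ⟨l, hl⟩
    obtain ⟨a, ha, rfl⟩ := hl.exists_of_skew
    exact ⟨a, ha, 1, ⟨[], DiGraph.isWalkFrom_nil.2 rfl, cWalk_nil c⟩, by simp⟩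
  · rintro ⟨a, ha, _, ⟨b, hb, rfl⟩, hk⟩
    rw [← cWalk_append, inv_mul_eq_iff_eq_mul] at hk
    rw [hk]
    exact (hb.append ha).skew_reachable c g
end

section
/- Let E be a directed graph, Γ a group, and c : E¹ → Γ a function. If the skew product graph E ×_c Γ is cofinal, then E is cofinal. -/
namespace DiGraph

variable {V E : Type} (G : DiGraph V E) {Γ : Type} [Group Γ] (c : E → Γ)

/-- The projection of the skew product onto the base graph sends paths to paths. -/
theorem isPathFrom_map_fst {v w : V × Γ} {l : List (E × Γ)}
    (h : (G.skew Γ c).IsPathFrom v w l) : G.IsPathFrom v.1 w.1 (l.map Prod.fst) := by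
  obtain ⟨hchain, hhead, hlast, hnil⟩ := h
  refine ⟨?_, ?_, ?_, ?_⟩
  · exact (List.isChain_map Prod.fst).2
      (List.IsChain.imp (fun _ _ h => congrArg Prod.fst h) hchain)
  · intro e he
    rw [List.head?_map, Option.mem_map] at he
    obtain ⟨a, ha, rfl⟩ := he
    exact congrArg Prod.fst (hhead a ha)
  · intro e he
    rw [List.getLast?_map, Option.mem_map] at he
    obtain ⟨a, ha, rfl⟩ := he
    exact congrArg Prod.fst (hlast a ha)
  · exact fun h => congrArg Prod.fst (hnil (List.map_eq_nil_iff.1 h))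

/-- The label of the first `n` edges of `x`. -/
def prefixLabel (x : ℕ → E) (n : ℕ) : Γ := ((List.range n).map (fun i => c (x i))).prod

/-- An infinite path lifts to the skew product, starting in the fibre over `1`. -/
theorem isInfPath_skewLift {x : ℕ → E} (hx : G.IsInfPath x) :
    (G.skew Γ c).IsInfPath (fun n => (x n, prefixLabel c x n)) := by
  intro i
  simp [skew, prefixLabel, List.range_succ, hx i]

end DiGraph

/-- If the skew product graph `E ×_c Γ` is cofinal then `E` is
cofinal. -/
theorem cofinal_of_skew_cofinal
    {V E : Type} (G : DiGraph V E) {Γ : Type} [Group Γ] (c : E → Γ)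
    (h : (G.skew Γ c).Cofinal) : G.Cofinal := by
  intro x hx v
  obtain ⟨n, l, hl⟩ := h _ (G.isInfPath_skewLift c hx) (v, 1)
  exact ⟨n, l.map Prod.fst, G.isPathFrom_map_fst c hl⟩
end

section
/- Let E be a row-finite directed graph with infinitely many vertices and no sinks, and suppose E is strongly connected or has no loops. Then for every vertex v and every n ≥ 1 there exists a v-deep path of length n, i.e. a path α = α₁…α_n with source v such that for each 1 ≤ i ≤ n the shortest path from v to r(α_i) has length exactly i. -/
namespace DiGraph

variable {V E : Type} (G : DiGraph V E)

theorem isPathFrom_nil {v w : V} : G.IsPathFrom v w [] ↔ v = w := by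
  simp [IsPathFrom, IsPath, List.Chain']

theorem isPathFrom_concat {v w : V} {l : List E} {e : E} :
    G.IsPathFrom v w (l ++ [e]) ↔ G.IsPathFrom v (G.s e) l ∧ G.r e = w := by
  cases l with
  | nil => simp [IsPathFrom, IsPath, List.Chain', eq_comm]
  | cons a t =>
    have hlast : (a :: (t ++ [e])).getLast? = some e := by
      rw [← List.cons_append, List.getLast?_concat]
    simp only [IsPathFrom, IsPath, List.Chain', List.isChain_append]
    simp [hlast]
    tauto

/-- The vertex `w` is at directed distance exactly `n` from `v`. -/
def IsDist (v w : V) (n : ℕ) : Prop :=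
  (∃ p : List E, p.length = n ∧ G.IsPathFrom v w p) ∧
    ∀ p : List E, G.IsPathFrom v w p → n ≤ p.length

variable {G}

theorem exists_isDist {v w : V} {p : List E} (hp : G.IsPathFrom v w p) :
    ∃ n, G.IsDist v w n := by
  classical
  have h : ∃ n, ∃ p : List E, p.length = n ∧ G.IsPathFrom v w p := ⟨_, p, rfl, hp⟩
  exact ⟨Nat.find h, Nat.find_spec h, fun q hq => Nat.find_min' h ⟨q, rfl, hq⟩⟩

theorem IsDist.exists_pred {v w : V} {n : ℕ} (h : G.IsDist v w (n + 1)) :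
    ∃ e : E, G.r e = w ∧ G.IsDist v (G.s e) n := by
  obtain ⟨⟨p, hpl, hp⟩, hmin⟩ := h
  rcases List.eq_nil_or_concat' p with rfl | ⟨l, e, rfl⟩
  · simp at hpl
  · rw [isPathFrom_concat] at hp
    refine ⟨e, hp.2, ⟨l, by simpa using hpl, hp.1⟩, fun q hq => ?_⟩
    simpa using hmin (q ++ [e]) (G.isPathFrom_concat.2 ⟨hq, hp.2⟩)

theorem IsDist.exists_of_le {v w : V} {m n : ℕ} (h : G.IsDist v w n) (hmn : m ≤ n) :
    ∃ u, G.IsDist v u m := by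
  induction n, hmn using Nat.le_induction generalizing w with
  | base => exact ⟨w, h⟩
  | succ n _ ih =>
    obtain ⟨e, -, he⟩ := h.exists_pred
    exact ih he

theorem IsDist.exists_deep {v w : V} {n : ℕ} (h : G.IsDist v w n) :
    ∃ l : List E, l.length = n ∧ G.IsPathFrom v w l ∧
      ∀ (i : ℕ) (hi : i < l.length), G.IsDist v (G.r l[i]) (i + 1) := by
  induction n generalizing w with
  | zero =>
    obtain ⟨p, hpl, hp⟩ := h.1
    exact ⟨p, hpl, hp, fun i hi => by omega⟩
  | succ n ih =>
    obtain ⟨e, rfl, he⟩ := h.exists_pred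
    obtain ⟨l, hl, hp, hd⟩ := ih he
    refine ⟨l ++ [e], by simp [hl], G.isPathFrom_concat.2 ⟨hp, rfl⟩, fun i hi => ?_⟩
    rcases Nat.lt_or_ge i l.length with hil | hil
    · rw [List.getElem_append_left hil]
      exact hd i hil
    · have : i = n := by simp at hi; omega
      subst this
      simpa [List.getElem_append_right hil, hl] using h

theorem finite_setOf_path_length_eq (hrow : ∀ v : V, {e : E | G.s e = v}.Finite)
    (v : V) (n : ℕ) : {w | ∃ p : List E, p.length = n ∧ G.IsPathFrom v w p}.Finite := by
  induction n with
  | zero =>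
    refine (Set.finite_singleton v).subset ?_
    rintro w ⟨p, hpl, hp⟩
    obtain rfl := List.length_eq_zero_iff.1 hpl
    exact (G.isPathFrom_nil.1 hp).symm
  | succ n ih =>
    refine (ih.biUnion fun u _ => (hrow u).image G.r).subset ?_
    rintro w ⟨p, hpl, hp⟩
    rcases List.eq_nil_or_concat' p with rfl | ⟨l, e, rfl⟩
    · simp at hpl
    · rw [isPathFrom_concat] at hp
      exact Set.mem_biUnion (x := G.s e) ⟨l, by simpa using hpl, hp.1⟩ ⟨e, rfl, hp.2⟩

theorem infinite_setOf_path_of_no_loop (hnosink : ∀ v : V, ∃ e : E, G.s e = v)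
    (hloop : ¬ ∃ (v : V) (l : List E), l ≠ [] ∧ G.IsPathFrom v v l) (v : V) :
    {w | ∃ p : List E, G.IsPathFrom v w p}.Infinite := by
  choose f hf using hnosink
  set x : ℕ → V := fun k => (fun u => G.r (f u))^[k] v with hx
  have hpath : ∀ i k, ∃ p : List E, p.length = k ∧ G.IsPathFrom (x i) (x (i + k)) p := by
    intro i k
    induction k with
    | zero => exact ⟨[], rfl, G.isPathFrom_nil.2 rfl⟩
    | succ k ih =>
      obtain ⟨p, hpl, hp⟩ := ih
      refine ⟨p ++ [f (x (i + k))], by simp [hpl], G.isPathFrom_concat.2 ⟨by rwa [hf], ?_⟩⟩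
      simp only [hx, ← add_assoc, Function.iterate_succ_apply']
  have hinj : Function.Injective x := by
    refine Function.Injective.of_lt_imp_ne fun i j hij heq => hloop ?_
    obtain ⟨p, hpl, hp⟩ := hpath i (j - i)
    rw [Nat.add_sub_cancel' hij.le, ← heq] at hp
    refine ⟨x i, p, ?_, hp⟩
    rintro rfl
    simp at hpl
    omega
  refine Set.infinite_of_injective_forall_mem hinj fun k => ?_
  obtain ⟨p, -, hp⟩ := hpath 0 k
  exact ⟨p, by simpa [hx] using hp⟩

theorem exists_isDist_of_infinite (hrow : ∀ v : V, {e : E | G.s e = v}.Finite) {v : V}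
    (hinf : {w | ∃ p : List E, G.IsPathFrom v w p}.Infinite) (n : ℕ) :
    ∃ w, G.IsDist v w n := by
  have hfin := (Set.finite_Iio n).biUnion fun k _ => finite_setOf_path_length_eq hrow v k
  obtain ⟨w, ⟨p, hp⟩, hw⟩ := hinf.exists_notMem_finite hfin
  obtain ⟨m, hm⟩ := exists_isDist hp
  refine hm.exists_of_le (le_of_not_gt fun hmn => hw ?_)
  exact Set.mem_biUnion (x := m) hmn hm.1

end DiGraph

/-- In a row-finite graph with infinitely many vertices and no sinks
which is strongly connected or has no loops, every vertex `v` admits `v`-deep paths of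
every length `n ≥ 1`: paths `α = α₁…α_n` with source `v` such that for each `i` the
shortest path from `v` to `r(α_i)` has length exactly `i`. -/
theorem exists_deep_path
    {V E : Type} (G : DiGraph V E)
    (hrow : ∀ v : V, {e : E | G.s e = v}.Finite)
    (hinf : Infinite V)
    (hnosink : ∀ v : V, ∃ e : E, G.s e = v)
    (hcase : G.StronglyConnected ∨ ¬ ∃ (v : V) (l : List E), l ≠ [] ∧ G.IsPathFrom v v l)
    (v : V) (n : ℕ) (hn : 1 ≤ n) :
    ∃ (l : List E) (w : V), l.length = n ∧ G.IsPathFrom v w l ∧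
      ∀ i : Fin l.length,
        (∃ p : List E, p.length = i.1 + 1 ∧ G.IsPathFrom v (G.r (l.get i)) p) ∧
        (∀ p : List E, G.IsPathFrom v (G.r (l.get i)) p → i.1 + 1 ≤ p.length) := by
  have hreach : {w | ∃ p : List E, G.IsPathFrom v w p}.Infinite := by
    rcases hcase with hconn | hloop
    · refine Set.infinite_univ.mono fun w _ => ?_
      obtain ⟨p, -, hp⟩ := hconn v w
      exact ⟨p, hp⟩
    · exact DiGraph.infinite_setOf_path_of_no_loop hnosink hloop v
  obtain ⟨w, hw⟩ := DiGraph.exists_isDist_of_infinite hrow hreach n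
  obtain ⟨l, hl, hp, hd⟩ := hw.exists_deep
  exact ⟨l, w, hl, hp, fun i => hd i.1 i.2⟩
end
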